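/- In any execution of the multi-writer auditable register implementation (Algorithm 1), consider a READ operation by process p_i that starts with local variable lsr = x0 and writes value x_k to H[i] in the k-th iteration of its repeat loop. Then for every index x with x0 < x < x_k and every sequence win stored in the sliding register SLR[x], i is not in READERS(win). -/

import Mathlib

/-!
# An operational model of Algorithm 1 (multi-writer auditable register)

The algorithm implements an `n`-writer `m`-reader auditable register from an
unbounded array `SLR[-1,0,1,...]` of `(m+n)`-sliding registers, a max register
`M` storing a triple `(widx, ridx, auditset)` (ordered by its first field,
modelled here as an atomic object), and an array `H[1..m]` of single-writer
registers.  Each line of the pseudo-code is a step; readers, writers and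
auditors are modelled by explicit program counters, and executions are
alternating sequences of configurations and labelled steps starting from the
initial configuration.
-/

namespace Alg1

/-- Values stored in the auditable register. -/
abbrev Val := ℕ

/-- Entries of the sliding registers: `w`-tuples `(w, j, v, h)` posted by
    writers (with `h` a helping set of readers) and reader identifiers. -/
inductive Entry (m n : ℕ) where
  | w (j : Fin n) (v : Val) (h : Finset (Fin m))
  | r (i : Fin m)

variable {m n : ℕ}

def Entry.isW : Entry m n → Bool
  | .w _ _ _ => true
  | .r _ => false

/-- Does the window contain a `w`-tuple? -/
def hasW (win : List (Entry m n)) : Bool := win.any Entry.isW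

/-- The first `w`-tuple in a window, if any. -/
def firstW : List (Entry m n) → Option (Fin n × Val × Finset (Fin m))
  | [] => none
  | .w j v h :: _ => some (j, v, h)
  | .r _ :: rest => firstW rest

/-- `getValue`: the value of the first `w`-tuple of a window (default `0`). -/
def wval (win : List (Entry m n)) : Val := ((firstW win).map fun t => t.2.1).getD 0

/-- Reader identifiers that precede every `w`-tuple of a window. -/
def preW : List (Entry m n) → Finset (Fin m)
  | [] => ∅
  | .w _ _ _ :: _ => ∅
  | .r i :: rest => insert i (preW rest)

/-- `READERS(win)`: readers preceding every `w`-tuple, together with the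
    helping set of the first `w`-tuple, if any. -/
def readersOf (win : List (Entry m n)) : Finset (Fin m) :=
  preW win ∪ ((firstW win).map fun t => t.2.2).getD ∅

/-- Content of the max register `M`: a triple `(widx, ridx, auditset)`,
    ordered by the first field. -/
structure MVal (m : ℕ) where
  widx : ℤ
  ridx : Fin m → ℤ
  aud : Finset (Fin m × Val)

/-- Semantics of `writeMax` on `M`. -/
def wmax (old new : MVal m) : MVal m := if old.widx < new.widx then new else old

/-- The triple written to `M` after reading window `win` from `SLR[x]`:
    `(x+1, ridx[j ∈ READERS(win)] := x, auditset ∪ {(j, lv) : j ∈ READERS(win)})`. -/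
def mArg (mc : MVal m) (win : List (Entry m n)) (x : ℤ) (lv : Val) : MVal m where
  widx := x + 1
  ridx := fun j => if j ∈ readersOf win then x else mc.ridx j
  aud := mc.aud ∪ (readersOf win).image fun j => (j, lv)

/-- Write to a `k`-sliding register: append, keeping the last `k` entries. -/
def slide (k : ℕ) (l : List (Entry m n)) (e : Entry m n) : List (Entry m n) :=
  let l' := l ++ [e]
  l'.drop (l'.length - k)

/-- Program counter of a reader (one state per line of the pseudo-code). -/
inductive RPC where
  | idle
  | precheck   -- read `SLR[lsr]` (line `rd_last_wd`)
  | preM       -- read `M` (line `new_write`)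
  | preHelp    -- `writeMax` on `M` (line `rd_help_M1`)
  | loopM      -- read `M` at the head of the repeat loop (line `rd_M`)
  | helpVal    -- found help: read `SLR[lsr-1]` (`getValue`, line `rd_return_help`)
  | annH       -- write `H[i] := lsr` (line `rd_annouce_att`)
  | wSLR       -- write `i` to `SLR[lsr]` (line `rd_do_att`)
  | rSLR       -- read `SLR[lsr]` (line `rd_do_att`)
  | gVal       -- read `SLR[lsr-1]` (`getValue`, line `rd_val`)
  | helpChk    -- help the pending write to complete (line `rd_help_M2`)
  | loopEnd    -- evaluate the until condition (line `rd_att_success`)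
  | retNow     -- return `lval`

structure RState (m n : ℕ) where
  lsr : ℤ
  lval : Val
  mc : MVal m
  win : List (Entry m n)
  it : ℕ          -- number of iterations of the repeat loop of the current READ
  pc : RPC

/-- Program counter of a writer. -/
inductive WPC where
  | idle
  | readM    -- read `M` (line `w_read_M`)
  | scanH    -- read `H[k]` (line `w_att`)
  | scanS    -- read `SLR[a_k]` (line `w_help_wd`)
  | post     -- write the `w`-tuple to `SLR[widx]` (line `w_write_SLR`)
  | postR    -- read `SLR[widx]`
  | postV    -- read `SLR[widx-1]` (`getValue`)
  | postM    -- `writeMax` on `M` (line `w_write_M`)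
  | wret     -- return

structure WState (m n : ℕ) where
  v : Val
  mc : MVal m
  toHelp : Finset (Fin m)
  k : ℕ
  a : ℤ
  win : List (Entry m n)
  val : Val
  pc : WPC

/-- Program counter of an auditor. -/
inductive APC where
  | idle
  | aM       -- read `M` (line `adt_read_M`)
  | aR       -- read `SLR[widx]` (line `adt_val`)
  | aV       -- read `SLR[widx-1]` (`getValue`, line `adt_val`)
  | aret     -- return the audit set

structure AState (m n : ℕ) where
  mc : MVal m
  win : List (Entry m n)
  val : Val
  pc : APC

/-- Processes: `m` readers, `n` writers, and arbitrarily many auditors. -/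
inductive Proc (m n : ℕ) where
  | rdr (i : Fin m)
  | wtr (j : Fin n)
  | adt (a : ℕ)
  deriving DecidableEq

/-- A configuration: shared memory plus the local state of every process. -/
structure Config (m n : ℕ) where
  slr : ℤ → List (Entry m n)
  M : MVal m
  H : Fin m → ℤ
  rst : Fin m → RState m n
  wst : Fin n → WState m n
  ast : ℕ → AState m n

/-- Step labels: invocations and responses of high-level operations, and
    primitive operations applied to the base objects. -/
inductive Lbl (m n : ℕ) where
  | invRead (i : Fin m)
  | respRead (i : Fin m) (v : Val)
  | invWrite (j : Fin n) (v : Val)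
  | respWrite (j : Fin n)
  | invAudit (a : ℕ)
  | respAudit (a : ℕ) (A : Finset (Fin m × Val))
  | slrRead (p : Proc m n) (x : ℤ) (win : List (Entry m n))
  | slrWrite (p : Proc m n) (x : ℤ) (e : Entry m n)
  | mRead (p : Proc m n) (v : MVal m)
  | mWrite (p : Proc m n) (v : MVal m)
  | hRead (j : Fin n) (k : Fin m) (a : ℤ)
  | hWrite (i : Fin m) (x : ℤ)
  | tau (p : Proc m n)

def upR (c : Config m n) (i : Fin m) (s : RState m n) : Config m n :=
  { c with rst := Function.update c.rst i s }

def upW (c : Config m n) (j : Fin n) (s : WState m n) : Config m n :=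
  { c with wst := Function.update c.wst j s }

def upA (c : Config m n) (a : ℕ) (s : AState m n) : Config m n :=
  { c with ast := Function.update c.ast a s }

/-- The transition relation of Algorithm 1. -/
def Step (c : Config m n) (l : Lbl m n) (c' : Config m n) : Prop :=
  match l with
  | .invRead i =>
      let s := c.rst i
      s.pc = .idle ∧
      c' = upR c i { s with it := 0, pc := if 0 ≤ s.lsr then RPC.precheck else RPC.loopM }
  | .respRead i v =>
      let s := c.rst i
      s.pc = .retNow ∧ v = s.lval ∧ c' = upR c i { s with pc := .idle }
  | .invWrite j v =>
      let s := c.wst j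
      s.pc = .idle ∧ c' = upW c j { s with v := v, pc := .readM }
  | .respWrite j =>
      let s := c.wst j
      s.pc = .wret ∧ c' = upW c j { s with pc := .idle }
  | .invAudit a =>
      let s := c.ast a
      s.pc = .idle ∧ c' = upA c a { s with pc := .aM }
  | .respAudit a A =>
      let s := c.ast a
      s.pc = .aret ∧
      A = s.mc.aud ∪ (readersOf s.win).image (fun j => (j, s.val)) ∧
      c' = upA c a { s with pc := .idle }
  | .slrRead p x win =>
      win = c.slr x ∧
      (match p with
       | .rdr i =>
          let s := c.rst i
          (s.pc = .precheck ∧ x = s.lsr ∧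
             c' = upR c i { s with win := win, pc := if hasW win then RPC.preM else RPC.retNow }) ∨
          (s.pc = .helpVal ∧ x = s.lsr - 1 ∧
             c' = upR c i { s with lval := wval win, pc := .retNow }) ∨
          (s.pc = .rSLR ∧ x = s.lsr ∧
             c' = upR c i { s with win := win, pc := .gVal }) ∨
          (s.pc = .gVal ∧ x = s.lsr - 1 ∧
             c' = upR c i { s with lval := wval win, pc := .helpChk })
       | .wtr j =>
          let s := c.wst j
          (s.pc = .scanS ∧ x = s.a ∧
             (∃ hk : s.k < m,
               c' = upW c j { s with toHelp := if (⟨s.k, hk⟩ : Fin m) ∈ readersOf win then s.toHelp else insert (⟨s.k, hk⟩ : Fin m) s.toHelp, k := s.k + 1, pc := .scanH })) ∨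
          (s.pc = .postR ∧ x = s.mc.widx ∧
             c' = upW c j { s with win := win, pc := .postV }) ∨
          (s.pc = .postV ∧ x = s.mc.widx - 1 ∧
             c' = upW c j { s with val := wval win, pc := .postM })
       | .adt a =>
          let s := c.ast a
          (s.pc = .aR ∧ x = s.mc.widx ∧
             c' = upA c a { s with win := win, pc := .aV }) ∨
          (s.pc = .aV ∧ x = s.mc.widx - 1 ∧
             c' = upA c a { s with val := wval win, pc := .aret }))
  | .slrWrite p x e =>
      (match p with
       | .rdr i =>
          let s := c.rst i
          s.pc = .wSLR ∧ x = s.lsr ∧ e = .r i ∧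
          c' = { upR c i { s with pc := .rSLR } with
                 slr := Function.update c.slr x (slide (m + n) (c.slr x) e) }
       | .wtr j =>
          let s := c.wst j
          s.pc = .post ∧ x = s.mc.widx ∧ e = .w j s.v s.toHelp ∧
          c' = { upW c j { s with pc := .postR } with
                 slr := Function.update c.slr x (slide (m + n) (c.slr x) e) }
       | .adt _ => False)
  | .mRead p v =>
      v = c.M ∧
      (match p with
       | .rdr i =>
          let s := c.rst i
          (s.pc = .preM ∧
             c' = upR c i { s with mc := v, pc := if v.widx = s.lsr then RPC.preHelp else RPC.loopM }) ∨
          (s.pc = .loopM ∧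
             c' = upR c i (if s.lsr < v.ridx i then
                { s with mc := v, it := s.it + 1, lsr := v.ridx i, pc := .helpVal }
              else
                { s with mc := v, it := s.it + 1, lsr := v.widx, pc := .annH }))
       | .wtr j =>
          let s := c.wst j
          s.pc = .readM ∧
          c' = upW c j { s with mc := v, toHelp := ∅, k := 0, pc := .scanH }
       | .adt a =>
          let s := c.ast a
          s.pc = .aM ∧ c' = upA c a { s with mc := v, pc := .aR })
  | .mWrite p v =>
      (match p with
       | .rdr i =>
          let s := c.rst i
          (s.pc = .preHelp ∧ v = mArg s.mc s.win s.lsr s.lval ∧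
             c' = { upR c i { s with pc := .loopM } with M := wmax c.M v }) ∨
          (s.pc = .helpChk ∧ hasW s.win = true ∧ v = mArg s.mc s.win s.lsr s.lval ∧
             c' = { upR c i { s with pc := .loopEnd } with M := wmax c.M v })
       | .wtr j =>
          let s := c.wst j
          s.pc = .postM ∧ v = mArg s.mc s.win s.mc.widx s.val ∧
          c' = { upW c j { s with pc := .wret } with M := wmax c.M v }
       | .adt _ => False)
  | .hRead j k a =>
      let s := c.wst j
      s.pc = .scanH ∧ (k : ℕ) = s.k ∧ a = c.H k ∧
      c' = upW c j (if s.mc.ridx k < a then { s with a := a, pc := .scanS }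
                    else { s with k := s.k + 1 })
  | .hWrite i x =>
      let s := c.rst i
      s.pc = .annH ∧ x = s.lsr ∧
      c' = { upR c i { s with pc := .wSLR } with H := Function.update c.H i x }
  | .tau p =>
      match p with
      | .rdr i =>
          let s := c.rst i
          (s.pc = .helpChk ∧ hasW s.win = false ∧
             c' = upR c i { s with pc := .loopEnd }) ∨
          (s.pc = .loopEnd ∧
             c' = upR c i { s with pc := if i ∈ readersOf s.win then RPC.retNow else RPC.loopM })
      | .wtr j =>
          let s := c.wst j
          s.pc = .scanH ∧ s.k = m ∧ c' = upW c j { s with pc := .post }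
      | .adt _ => False

/-- The initial configuration: `SLR[-1]` holds `(w, j₀, v₀, ∅)`, all other
    sliding registers are empty, `M = (0, [-1,…,-1], ∅)`, `H = [-1,…,-1]`,
    and every process is idle (readers start with `lsr = -1`). -/
def init (m n : ℕ) (v0 : Val) (j0 : Fin n) : Config m n where
  slr := fun x => if x = -1 then [.w j0 v0 ∅] else []
  M := ⟨0, fun _ => -1, ∅⟩
  H := fun _ => -1
  rst := fun _ => ⟨-1, v0, ⟨0, fun _ => -1, ∅⟩, [], 0, .idle⟩
  wst := fun _ => ⟨v0, ⟨0, fun _ => -1, ∅⟩, ∅, 0, -1, [], v0, .idle⟩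
  ast := fun _ => ⟨⟨0, fun _ => -1, ∅⟩, [], v0, .idle⟩

/-- A finite execution of Algorithm 1: configurations `cfg 0, …, cfg len`
    connected by labelled steps. -/
structure Exec (m n : ℕ) (v0 : Val) (j0 : Fin n) where
  len : ℕ
  cfg : ℕ → Config m n
  lbl : ℕ → Lbl m n
  h0 : cfg 0 = init m n v0 j0
  hstep : ∀ t, t < len → Step (cfg t) (lbl t) (cfg (t + 1))

variable {v0 : Val} {j0 : Fin n}

/-! ### Derived notions -/

/-- The process performing a step. -/
def procOf : Lbl m n → Proc m n
  | .invRead i => .rdr i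
  | .respRead i _ => .rdr i
  | .invWrite j _ => .wtr j
  | .respWrite j => .wtr j
  | .invAudit a => .adt a
  | .respAudit a _ => .adt a
  | .slrRead p _ _ => p
  | .slrWrite p _ _ => p
  | .mRead p _ => p
  | .mWrite p _ => p
  | .hRead j _ _ => .wtr j
  | .hWrite i _ => .rdr i
  | .tau p => p

/-- The label writes a `w`-tuple to `SLR[x]`. -/
def isWWrite (l : Lbl m n) (x : ℤ) : Prop :=
  ∃ p j v h, l = .slrWrite p x (.w j v h)

/-- Step `t` is the first write of a `w`-tuple to `SLR[x]` in the execution. -/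
def FirstWWriteAt (E : Exec m n v0 j0) (x : ℤ) (t : ℕ) : Prop :=
  t < E.len ∧ isWWrite (E.lbl t) x ∧ ∀ t', t' < t → ¬ isWWrite (E.lbl t') x

/-- Step `t` changes `M.widx` from `ℓ - 1` to `ℓ`. -/
def WidxChangeAt (E : Exec m n v0 j0) (ℓ : ℤ) (t : ℕ) : Prop :=
  t < E.len ∧ (∃ p v, E.lbl t = .mWrite p v) ∧
  (E.cfg t).M.widx = ℓ - 1 ∧ (E.cfg (t + 1)).M.widx = ℓ

/-- `x` is the largest index of a sliding register containing a `w`-tuple. -/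
def WIDXis (c : Config m n) (x : ℤ) : Prop :=
  hasW (c.slr x) = true ∧ ∀ y : ℤ, x < y → hasW (c.slr y) = false

/-- Configuration in region `D_ℓ`: `M.widx = ℓ = WIDX + 1`. -/
def inD (c : Config m n) (ℓ : ℤ) : Prop := c.M.widx = ℓ ∧ WIDXis c (ℓ - 1)

/-- Configuration in region `E_ℓ`: `M.widx = ℓ = WIDX`. -/
def inE (c : Config m n) (ℓ : ℤ) : Prop := c.M.widx = ℓ ∧ WIDXis c ℓ

/-! ### Classification of operations, and linearizations -/

/-- Classification of the operations of Algorithm 1. -/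
inductive Kind where
  | silentR | directR | helpedR | visibleW | hiddenW | defA | nondefA
  deriving DecidableEq

/-- Rank used by the linearization rules `R1`–`R4` within a block of
    operations with the same index. -/
def rank : Kind → ℕ
  | .silentR => 0
  | .directR => 0
  | .nondefA => 0
  | .helpedR => 1
  | .defA => 2
  | .hiddenW => 3
  | .visibleW => 4

def Kind.isRead : Kind → Prop
  | .silentR => True | .directR => True | .helpedR => True
  | _ => False

def Kind.isWrite : Kind → Prop
  | .visibleW => True | .hiddenW => True
  | _ => False

def Kind.isAudit : Kind → Prop
  | .defA => True | .nondefA => True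
  | _ => False

/-- The data of a classified operation: its process, invocation step, optional
    response step, kind, associated sliding-register index `idx`, its
    characteristic step `key` on `SLR[idx]` (used by the linearization rules),
    its value (return value of a READ / input of a WRITE) and, for an AUDIT,
    the returned audit set. -/
structure OpData (m n : ℕ) where
  proc : Proc m n
  inv : ℕ
  resp : Option ℕ
  kind : Kind
  idx : ℤ
  key : ℕ
  val : Val
  aset : Finset (Fin m × Val)

/-- The label is a response event of process `p`. -/
def isRespOf (l : Lbl m n) (p : Proc m n) : Prop :=
  (∃ i v, p = .rdr i ∧ l = .respRead i v) ∨
  (∃ j, p = .wtr j ∧ l = .respWrite j) ∨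
  (∃ a A, p = .adt a ∧ l = .respAudit a A)

/-- `resp` is the matching response of the operation of `p` invoked at `a`
    (or the operation is pending if `resp = none`). -/
def RespMatch (E : Exec m n v0 j0) (p : Proc m n) (a : ℕ) : Option ℕ → Prop
  | some b => a < b ∧ b < E.len ∧ isRespOf (E.lbl b) p ∧
      ∀ t, a < t → t < b → ¬ isRespOf (E.lbl t) p
  | none => ∀ t, a < t → t < E.len → ¬ isRespOf (E.lbl t) p

/-- `x` is the smallest index `> x0` of a sliding register in which reader `i`
    is recorded (evaluated in the final configuration). -/
def minRecIdx (E : Exec m n v0 j0) (i : Fin m) (x0 x : ℤ) : Prop :=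
  x0 < x ∧ i ∈ readersOf ((E.cfg E.len).slr x) ∧
    ∀ y : ℤ, x0 < y → y < x → i ∉ readersOf ((E.cfg E.len).slr y)

/-- The return value of a classified READ: the actual response if the READ is
    complete; for a pending classified READ (completed in `H'`), the value of
    the first `w`-tuple of `SLR[idx-1]`. -/
def ReadValOK (E : Exec m n v0 j0) (o : OpData m n) (i : Fin m) : Prop :=
  match o.resp with
  | some b => E.lbl b = .respRead i o.val
  | none => o.val = wval ((E.cfg E.len).slr (o.idx - 1))

/-- `o` describes a classified operation of the execution `E`. -/
def IsOp (E : Exec m n v0 j0) (o : OpData m n) : Prop :=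
  o.inv < E.len ∧ RespMatch E o.proc o.inv o.resp ∧
  match o.kind with
  | .silentR =>
      ∃ i b win, o.proc = .rdr i ∧ o.resp = some b ∧
        E.lbl o.inv = .invRead i ∧
        (∃ t', t' < o.inv ∧ E.lbl t' = .invRead i) ∧
        o.idx = ((E.cfg o.inv).rst i).lsr ∧
        o.inv < o.key ∧ o.key < b ∧
        E.lbl o.key = .slrRead (.rdr i) o.idx win ∧
        ((E.cfg o.key).rst i).pc = .precheck ∧
        hasW win = false ∧
        E.lbl b = .respRead i o.val ∧
        o.aset = ∅
  | .directR =>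
      ∃ i, o.proc = .rdr i ∧ E.lbl o.inv = .invRead i ∧
        minRecIdx E i ((E.cfg o.inv).rst i).lsr o.idx ∧
        i ∈ preW ((E.cfg E.len).slr o.idx) ∧
        o.inv < o.key ∧ o.key < E.len ∧
        E.lbl o.key = .slrWrite (.rdr i) o.idx (.r i) ∧
        (∀ b, o.resp = some b → o.key < b) ∧
        ReadValOK E o i ∧ o.aset = ∅
  | .helpedR =>
      ∃ i, o.proc = .rdr i ∧ E.lbl o.inv = .invRead i ∧
        minRecIdx E i ((E.cfg o.inv).rst i).lsr o.idx ∧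
        i ∉ preW ((E.cfg E.len).slr o.idx) ∧
        o.key = o.inv ∧ ReadValOK E o i ∧ o.aset = ∅
  | .visibleW =>
      ∃ j h, o.proc = .wtr j ∧ E.lbl o.inv = .invWrite j o.val ∧
        o.inv < o.key ∧ o.key < E.len ∧
        E.lbl o.key = .slrWrite (.wtr j) o.idx (.w j o.val h) ∧
        (∀ b, o.resp = some b → o.key < b) ∧
        firstW ((E.cfg E.len).slr o.idx) = some (j, o.val, h) ∧
        o.aset = ∅
  | .hiddenW =>
      ∃ j h, o.proc = .wtr j ∧ E.lbl o.inv = .invWrite j o.val ∧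
        o.inv < o.key ∧ o.key < E.len ∧
        E.lbl o.key = .slrWrite (.wtr j) o.idx (.w j o.val h) ∧
        (∀ b, o.resp = some b → o.key < b) ∧
        firstW ((E.cfg E.len).slr o.idx) ≠ some (j, o.val, h) ∧
        o.aset = ∅
  | .defA =>
      ∃ a b tM mv win, o.proc = .adt a ∧ o.resp = some b ∧
        E.lbl o.inv = .invAudit a ∧
        o.inv < tM ∧ tM < o.key ∧ o.key < b ∧
        E.lbl tM = .mRead (.adt a) mv ∧ ((E.cfg tM).ast a).pc = .aM ∧
        o.idx = mv.widx ∧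
        E.lbl o.key = .slrRead (.adt a) o.idx win ∧
        ((E.cfg o.key).ast a).pc = .aR ∧
        hasW win = true ∧
        E.lbl b = .respAudit a o.aset ∧ o.val = 0
  | .nondefA =>
      ∃ a b tM mv win, o.proc = .adt a ∧ o.resp = some b ∧
        E.lbl o.inv = .invAudit a ∧
        o.inv < tM ∧ tM < o.key ∧ o.key < b ∧
        E.lbl tM = .mRead (.adt a) mv ∧ ((E.cfg tM).ast a).pc = .aM ∧
        o.idx = mv.widx ∧
        E.lbl o.key = .slrRead (.adt a) o.idx win ∧
        ((E.cfg o.key).ast a).pc = .aR ∧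
        hasW win = false ∧
        E.lbl b = .respAudit a o.aset ∧ o.val = 0

/-- `o` terminates (its response event occurs) before `o'` starts. -/
def EndsBefore (o o' : OpData m n) : Prop :=
  ∃ b, o.resp = some b ∧ b < o'.inv

/-- `lt` is a linearization of the classified operations of `E` obeying the
    rules `R0`–`R4`: a strict total order on classified operations, ordering
    operations by increasing `idx` (`R0`); within the same `idx`, first
    silent READs, direct READs and non-definitive AUDITs ordered by their
    characteristic step on `SLR[idx]` (`R1`), then helped READs in arbitrary
    order followed by the definitive AUDITs ordered by their read of
    `SLR[idx]` (`R2`), then the hidden WRITEs ordered by their write to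
    `SLR[idx]` (`R3`), and the visible WRITE last (`R4`). -/
def LinOK (E : Exec m n v0 j0) (lt : OpData m n → OpData m n → Prop) : Prop :=
  (∀ o, IsOp E o → ¬ lt o o) ∧
  (∀ o₁ o₂ o₃, IsOp E o₁ → IsOp E o₂ → IsOp E o₃ →
      lt o₁ o₂ → lt o₂ o₃ → lt o₁ o₃) ∧
  (∀ o₁ o₂, IsOp E o₁ → IsOp E o₂ → o₁ ≠ o₂ → lt o₁ o₂ ∨ lt o₂ o₁) ∧
  (∀ o₁ o₂, IsOp E o₁ → IsOp E o₂ → o₁.idx < o₂.idx → lt o₁ o₂) ∧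
  (∀ o₁ o₂, IsOp E o₁ → IsOp E o₂ → o₁.idx = o₂.idx →
      rank o₁.kind < rank o₂.kind → lt o₁ o₂) ∧
  (∀ o₁ o₂, IsOp E o₁ → IsOp E o₂ → o₁.idx = o₂.idx →
      rank o₁.kind = rank o₂.kind → o₁.kind ≠ .helpedR →
      o₁.key < o₂.key → lt o₁ o₂)

/-! ### Auxiliary facts for the proof -/

def pid : Entry m n → Fin m ⊕ Fin n
  | .w j _ _ => .inr j
  | .r i => .inl i

theorem hasW_append (l r : List (Entry m n)) : hasW (l ++ r) = (hasW l || hasW r) := by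
  simp [hasW]

theorem readersOf_cons_r (i : Fin m) (l : List (Entry m n)) :
    readersOf (.r i :: l) = insert i (readersOf l) := by
  simp [readersOf, preW, firstW]

theorem readersOf_cons_w (j : Fin n) (v : Val) (h : Finset (Fin m)) (l : List (Entry m n)) :
    readersOf (.w j v h :: l) = h := by
  simp [readersOf, preW, firstW]

theorem readersOf_append_of_hasW (l r : List (Entry m n)) (h : hasW l = true) :
    readersOf (l ++ r) = readersOf l := by
  induction l with
  | nil => simp [hasW] at h
  | cons e l ih =>
    cases e with
    | w j v s => simp [readersOf_cons_w]
    | r i =>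
      have : hasW l = true := by simpa [hasW, Entry.isW] using h
      simp [readersOf_cons_r, ih this]

theorem readersOf_append_subset (l r : List (Entry m n)) :
    readersOf l ⊆ readersOf (l ++ r) := by
  induction l with
  | nil => simp [readersOf, preW, firstW]
  | cons e l ih =>
    cases e with
    | w j v s => simp [readersOf_cons_w]
    | r i =>
      simp only [List.cons_append, readersOf_cons_r]
      exact Finset.insert_subset_insert _ ih

theorem mem_readersOf (l : List (Entry m n)) (h : hasW l = false) (i : Fin m)
    (hi : Entry.r i ∈ l) : i ∈ readersOf l := by
  induction l with
  | nil => simp at hi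
  | cons e l ih =>
    cases e with
    | w j v s => simp [hasW, Entry.isW] at h
    | r k =>
      have h' : hasW l = false := by simpa [hasW, Entry.isW] using h
      rw [readersOf_cons_r]
      simp only [List.mem_cons, Entry.r.injEq] at hi
      rcases hi with rfl | hi
      · simp
      · exact Finset.mem_insert_of_mem (ih h' hi)

theorem slide_eq (l : List (Entry m n)) (e : Entry m n)
    (h : ((l ++ [e]).map pid).Nodup) : slide (m + n) l e = l ++ [e] := by
  have := h.length_le_card
  simp only [List.length_map, Fintype.card_sum, Fintype.card_fin] at this
  have h0 : (l ++ [e]).length - (m + n) = 0 := by omega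
  simp only [slide, h0, List.drop_zero]

/-- Every sliding register only grows. -/
def Ext (s s' : ℤ → List (Entry m n)) : Prop := ∀ x, s x <+: s' x

theorem Ext.rfl' {s : ℤ → List (Entry m n)} : Ext s s := fun _ => List.prefix_rfl

theorem Ext.hasW {s s' : ℤ → List (Entry m n)} (h : Ext s s') {x : ℤ}
    (hw : hasW (s x) = true) : hasW (s' x) = true := by
  obtain ⟨r, hr⟩ := h x
  rw [← hr, hasW_append, hw]; rfl

theorem Ext.readers {s s' : ℤ → List (Entry m n)} (h : Ext s s') {x : ℤ}
    (hw : Alg1.hasW (s x) = true) : readersOf (s' x) = readersOf (s x) := by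
  obtain ⟨r, hr⟩ := h x
  rw [← hr, readersOf_append_of_hasW _ _ hw]

theorem Ext.sub {s s' : ℤ → List (Entry m n)} (h : Ext s s') (x : ℤ) :
    readersOf (s x) ⊆ readersOf (s' x) := by
  obtain ⟨r, hr⟩ := h x
  rw [← hr]; exact readersOf_append_subset _ _

def MOK (slr : ℤ → List (Entry m n)) (v : MVal m) : Prop :=
  0 ≤ v.widx ∧ (∀ x, -1 ≤ x → x < v.widx → hasW (slr x) = true) ∧
  ∀ j, -1 ≤ v.ridx j ∧ v.ridx j < v.widx ∧
    ∀ x, v.ridx j < x → x < v.widx → j ∉ readersOf (slr x)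

theorem MOK.ext {s s' : ℤ → List (Entry m n)} (h : Ext s s') {v : MVal m} (hv : MOK s v) :
    MOK s' v := by
  obtain ⟨a, b, c⟩ := hv
  refine ⟨a, fun x h1 h2 => h.hasW (b x h1 h2), fun j => ?_⟩
  obtain ⟨c1, c2, c3⟩ := c j
  refine ⟨c1, c2, fun x h1 h2 => ?_⟩
  rw [h.readers (b x (by omega) h2)]
  exact c3 x h1 h2

/-- `win` is a window holding a `w`-tuple whose readers are those of `SLR[x]`. -/
def Fixed (slr : ℤ → List (Entry m n)) (x : ℤ) (win : List (Entry m n)) : Prop :=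
  hasW win = true ∧ hasW (slr x) = true ∧ readersOf (slr x) = readersOf win

theorem Fixed.ext {s s' : ℤ → List (Entry m n)} (h : Ext s s') {x : ℤ}
    {win : List (Entry m n)} (hf : Fixed s x win) : Fixed s' x win :=
  ⟨hf.1, h.hasW hf.2.1, (h.readers hf.2.1).trans hf.2.2⟩

theorem MOK.mArg {slr : ℤ → List (Entry m n)} {mc : MVal m} {win : List (Entry m n)} {x : ℤ}
    (hm : MOK slr mc) (hx : mc.widx = x) (hf : Fixed slr x win) (lv : Val) :
    MOK slr (mArg mc win x lv) := by
  subst hx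
  obtain ⟨a, b, c⟩ := hm
  obtain ⟨-, f2, f3⟩ := hf
  refine ⟨by simp only [Alg1.mArg]; omega, fun y h1 h2 => ?_, fun j => ?_⟩
  · simp only [Alg1.mArg] at h2
    rcases eq_or_lt_of_le (show y ≤ mc.widx by omega) with rfl | h
    · exact f2
    · exact b y h1 h
  · obtain ⟨c1, c2, c3⟩ := c j
    simp only [Alg1.mArg]
    split_ifs with hj
    · exact ⟨by omega, by omega, fun y h1 h2 => by omega⟩
    · refine ⟨c1, by omega, fun y h1 h2 => ?_⟩
      rcases eq_or_lt_of_le (show y ≤ mc.widx by omega) with rfl | h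
      · rw [f3]; exact hj
      · exact c3 y h1 h

def RPCOK (i : Fin m) (slr : ℤ → List (Entry m n)) (Mw : ℤ) (s : RState m n) : RPC → Prop
  | .idle => True
  | .precheck => True
  | .retNow => True
  | .helpVal => True
  | .preM => Fixed slr s.lsr s.win
  | .preHelp => Fixed slr s.lsr s.win ∧ s.mc.widx = s.lsr
  | .loopM => s.lsr < Mw
  | .annH => s.mc.widx = s.lsr ∧ ∀ x, Entry.r i ∈ slr x → x < s.lsr
  | .wSLR => s.mc.widx = s.lsr ∧ ∀ x, Entry.r i ∈ slr x → x < s.lsr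
  | .rSLR => s.mc.widx = s.lsr ∧ Entry.r i ∈ slr s.lsr
  | .gVal => s.mc.widx = s.lsr ∧ (hasW s.win = true → Fixed slr s.lsr s.win) ∧
      (hasW s.win = false → i ∈ readersOf s.win)
  | .helpChk => s.mc.widx = s.lsr ∧ (hasW s.win = true → Fixed slr s.lsr s.win) ∧
      (hasW s.win = false → i ∈ readersOf s.win)
  | .loopEnd => (hasW s.win = true → Fixed slr s.lsr s.win) ∧
      (hasW s.win = false → i ∈ readersOf s.win) ∧ (hasW s.win = true → s.lsr < Mw)

structure ROK (i : Fin m) (slr : ℤ → List (Entry m n)) (Mw : ℤ) (s : RState m n) : Prop where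
  lo : -1 ≤ s.lsr
  hi : s.lsr ≤ Mw
  mok : MOK slr s.mc
  mle : s.mc.widx ≤ Mw
  ent : ∀ x, Entry.r i ∈ slr x → x ≤ s.lsr
  pcok : RPCOK i slr Mw s s.pc

theorem ROK.frame {i : Fin m} {slr slr' : ℤ → List (Entry m n)} {Mw Mw' : ℤ} {s : RState m n}
    (h : ROK i slr Mw s) (he : Ext slr slr') (hM : Mw ≤ Mw')
    (hn : ∀ x, Entry.r i ∈ slr' x → Entry.r i ∈ slr x) : ROK i slr' Mw' s := by
  obtain ⟨a, b, c, d, e, f⟩ := h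
  refine ⟨a, by omega, c.ext he, by omega, fun x hx => e x (hn x hx), ?_⟩
  generalize s.pc = pc at f ⊢
  cases pc <;> simp only [RPCOK] at f ⊢
  · exact f.ext he
  · exact ⟨f.1.ext he, f.2⟩
  · omega
  · exact ⟨f.1, fun x hx => f.2 x (hn x hx)⟩
  · exact ⟨f.1, fun x hx => f.2 x (hn x hx)⟩
  · exact ⟨f.1, (he _).subset f.2⟩
  · exact ⟨f.1, fun hw => (f.2.1 hw).ext he, f.2.2⟩
  · exact ⟨f.1, fun hw => (f.2.1 hw).ext he, f.2.2⟩
  · exact ⟨fun hw => (f.1 hw).ext he, f.2.1, fun hw => by have := f.2.2 hw; omega⟩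

def WPCOK (j : Fin n) (slr : ℤ → List (Entry m n)) (Mw : ℤ) (s : WState m n) : WPC → Prop
  | .idle => ∀ x v h, Entry.w j v h ∈ slr x → x < Mw
  | .readM => ∀ x v h, Entry.w j v h ∈ slr x → x < Mw
  | .wret => ∀ x v h, Entry.w j v h ∈ slr x → x < Mw
  | .scanH => ∀ x v h, Entry.w j v h ∈ slr x → x < s.mc.widx
  | .scanS => ∀ x v h, Entry.w j v h ∈ slr x → x < s.mc.widx
  | .post => ∀ x v h, Entry.w j v h ∈ slr x → x < s.mc.widx
  | .postR => (∀ x v h, Entry.w j v h ∈ slr x → x ≤ s.mc.widx) ∧ hasW (slr s.mc.widx) = true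
  | .postV => (∀ x v h, Entry.w j v h ∈ slr x → x ≤ s.mc.widx) ∧ Fixed slr s.mc.widx s.win
  | .postM => (∀ x v h, Entry.w j v h ∈ slr x → x ≤ s.mc.widx) ∧ Fixed slr s.mc.widx s.win

structure WOK (j : Fin n) (slr : ℤ → List (Entry m n)) (Mw : ℤ) (s : WState m n) : Prop where
  mok : MOK slr s.mc
  mle : s.mc.widx ≤ Mw
  pcok : WPCOK j slr Mw s s.pc

theorem WOK.frame {j : Fin n} {slr slr' : ℤ → List (Entry m n)} {Mw Mw' : ℤ} {s : WState m n}
    (h : WOK j slr Mw s) (he : Ext slr slr') (hM : Mw ≤ Mw')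
    (hn : ∀ x v h, Entry.w j v h ∈ slr' x → Entry.w j v h ∈ slr x) : WOK j slr' Mw' s := by
  obtain ⟨c, d, f⟩ := h
  refine ⟨c.ext he, by omega, ?_⟩
  generalize s.pc = pc at f ⊢
  cases pc <;> simp only [WPCOK] at f ⊢
  · exact fun x v h hx => lt_of_lt_of_le (f x v h (hn x v h hx)) hM
  · exact fun x v h hx => lt_of_lt_of_le (f x v h (hn x v h hx)) hM
  · exact fun x v h hx => f x v h (hn x v h hx)
  · exact fun x v h hx => f x v h (hn x v h hx)
  · exact fun x v h hx => f x v h (hn x v h hx)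
  · exact ⟨fun x v h hx => f.1 x v h (hn x v h hx), he.hasW f.2⟩
  · exact ⟨fun x v h hx => f.1 x v h (hn x v h hx), f.2.ext he⟩
  · exact ⟨fun x v h hx => f.1 x v h (hn x v h hx), f.2.ext he⟩
  · exact fun x v h hx => lt_of_lt_of_le (f x v h (hn x v h hx)) hM

structure Inv (c : Config m n) : Prop where
  mok : MOK c.slr c.M
  nd : ∀ x, ((c.slr x).map pid).Nodup
  rok : ∀ i, ROK i c.slr c.M.widx (c.rst i)
  wok : ∀ j, WOK j c.slr c.M.widx (c.wst j)

theorem Inv.init (m n : ℕ) (v0 : Val) (j0 : Fin n) : Inv (init m n v0 j0) := by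
  have hM : MOK (Alg1.init m n v0 j0).slr ⟨0, fun _ => -1, ∅⟩ := by
    refine ⟨le_rfl, fun x h1 h2 => ?_, fun j => ⟨le_rfl, by simp, fun x h1 h2 => ?_⟩⟩
    · simp only at h2
      obtain rfl : x = -1 := by omega
      simp [Alg1.init, hasW, Entry.isW]
    · simp only at h1 h2; omega
  refine ⟨hM, fun x => ?_, fun i => ⟨le_rfl, by simp [Alg1.init], hM, le_rfl, fun x hx => ?_, trivial⟩,
    fun j => ⟨hM, le_rfl, ?_⟩⟩
  · simp only [Alg1.init]; split_ifs <;> simp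
  · simp only [Alg1.init] at hx; split_ifs at hx <;> simp at hx
  · simp only [Alg1.init, WPCOK]
    intro x v h hx
    split_ifs at hx with hh
    · omega
    · simp at hx

/-- A step of reader `i` that only changes its local state and possibly `M`. -/
theorem Inv.stepR {c c' : Config m n} (hc : Inv c) (i : Fin m) (s : RState m n)
    (h1 : c'.rst = Function.update c.rst i s) (h2 : c'.wst = c.wst) (h3 : c'.slr = c.slr)
    (h4 : MOK c.slr c'.M) (h5 : c.M.widx ≤ c'.M.widx)
    (h6 : ROK i c.slr c'.M.widx s) : Inv c' := by
  refine ⟨by rw [h3]; exact h4, by rw [h3]; exact hc.nd, fun k => ?_, fun j => ?_⟩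
  · rw [h3, h1]
    by_cases hk : k = i
    · subst hk; simpa using h6
    · rw [Function.update_of_ne hk]
      exact (hc.rok k).frame Ext.rfl' h5 (fun _ h => h)
  · rw [h3, h2]; exact (hc.wok j).frame Ext.rfl' h5 (fun _ _ _ h => h)

theorem Inv.stepW {c c' : Config m n} (hc : Inv c) (i : Fin n) (s : WState m n)
    (h1 : c'.wst = Function.update c.wst i s) (h2 : c'.rst = c.rst) (h3 : c'.slr = c.slr)
    (h4 : MOK c.slr c'.M) (h5 : c.M.widx ≤ c'.M.widx)
    (h6 : WOK i c.slr c'.M.widx s) : Inv c' := by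
  refine ⟨by rw [h3]; exact h4, by rw [h3]; exact hc.nd, fun k => ?_, fun j => ?_⟩
  · rw [h3, h2]; exact (hc.rok k).frame Ext.rfl' h5 (fun _ h => h)
  · rw [h3, h1]
    by_cases hk : j = i
    · subst hk; simpa using h6
    · rw [Function.update_of_ne hk]
      exact (hc.wok j).frame Ext.rfl' h5 (fun _ _ _ h => h)

theorem wmax_ge (a b : MVal m) : a.widx ≤ (wmax a b).widx ∧ b.widx ≤ (wmax a b).widx := by
  unfold wmax; split_ifs <;> constructor <;> omega

theorem wmax_mok {slr : ℤ → List (Entry m n)} {a b : MVal m} (ha : MOK slr a) (hb : MOK slr b) :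
    MOK slr (wmax a b) := by
  unfold wmax; split_ifs <;> assumption

theorem ext_update {slr : ℤ → List (Entry m n)} (x : ℤ) (e : Entry m n) :
    Ext slr (Function.update slr x (slr x ++ [e])) := by
  intro y
  by_cases h : y = x
  · subst h; simp
  · rw [Function.update_of_ne h]

theorem mem_update {slr : ℤ → List (Entry m n)} {x y : ℤ} {e e' : Entry m n}
    (h : e' ∈ Function.update slr x (slr x ++ [e]) y) : e' ∈ slr y ∨ (e' = e ∧ y = x) := by
  by_cases hy : y = x
  · subst hy; simpa using h
  · rw [Function.update_of_ne hy] at h; exact .inl h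

theorem nd_append {l : List (Entry m n)} {e : Entry m n} (h : (l.map pid).Nodup)
    (h' : ∀ e' ∈ l, pid e' ≠ pid e) : ((l ++ [e]).map pid).Nodup := by
  rw [List.map_append, List.nodup_append]
  refine ⟨h, by simp, ?_⟩
  intro a ha b hb
  simp only [List.mem_map] at ha
  obtain ⟨e', he', rfl⟩ := ha
  simp only [List.map_cons, List.map_nil, List.mem_singleton] at hb
  rw [hb]; exact h' e' he'

theorem nd_update {slr : ℤ → List (Entry m n)} {x : ℤ} {e : Entry m n}
    (h : ∀ x, ((slr x).map pid).Nodup) (h' : ((slr x ++ [e]).map pid).Nodup) (y : ℤ) :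
    ((Function.update slr x (slr x ++ [e]) y).map pid).Nodup := by
  by_cases hy : y = x
  · subst hy; simpa using h'
  · rw [Function.update_of_ne hy]; exact h y

/-- One step preserves the invariant, and the sliding registers only grow. -/
theorem Inv.step {c c' : Config m n} {l : Lbl m n} (hc : Inv c) (hs : Step c l c') :
    Inv c' ∧ Ext c.slr c'.slr := by
  cases l with
  | invRead i =>
    obtain ⟨hp, rfl⟩ := hs
    obtain ⟨a, b, d, e, f, -⟩ := hc.rok i
    refine ⟨hc.stepR i _ rfl rfl rfl hc.mok le_rfl ⟨a, b, d, e, f, ?_⟩, Ext.rfl'⟩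
    have := hc.mok.1
    simp only
    split_ifs
    · trivial
    · simp only [RPCOK, upR]; omega
  | respRead i v =>
    obtain ⟨hp, -, rfl⟩ := hs
    obtain ⟨a, b, d, e, f, -⟩ := hc.rok i
    exact ⟨hc.stepR i _ rfl rfl rfl hc.mok le_rfl ⟨a, b, d, e, f, trivial⟩, Ext.rfl'⟩
  | invWrite j v =>
    obtain ⟨hp, rfl⟩ := hs
    obtain ⟨d, e, f⟩ := hc.wok j
    rw [hp] at f
    exact ⟨hc.stepW j _ rfl rfl rfl hc.mok le_rfl ⟨d, e, f⟩, Ext.rfl'⟩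
  | respWrite j =>
    obtain ⟨hp, rfl⟩ := hs
    obtain ⟨d, e, f⟩ := hc.wok j
    rw [hp] at f
    exact ⟨hc.stepW j _ rfl rfl rfl hc.mok le_rfl ⟨d, e, f⟩, Ext.rfl'⟩
  | invAudit a =>
    obtain ⟨hp, rfl⟩ := hs
    exact ⟨⟨hc.mok, hc.nd, hc.rok, hc.wok⟩, Ext.rfl'⟩
  | respAudit a A =>
    obtain ⟨hp, -, rfl⟩ := hs
    exact ⟨⟨hc.mok, hc.nd, hc.rok, hc.wok⟩, Ext.rfl'⟩
  | slrRead p x win =>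
    obtain ⟨rfl, hs⟩ := hs
    cases p with
    | rdr i =>
      obtain ⟨a, b, d, e, f, g⟩ := hc.rok i
      rcases hs with ⟨hp, rfl, rfl⟩ | ⟨hp, rfl, rfl⟩ | ⟨hp, rfl, rfl⟩ | ⟨hp, rfl, rfl⟩ <;>
        rw [hp] at g <;>
        refine ⟨hc.stepR i _ rfl rfl rfl hc.mok le_rfl ⟨a, b, d, e, f, ?_⟩, Ext.rfl'⟩
      · simp only
        split_ifs with hw
        · exact ⟨hw, hw, rfl⟩
        · trivial
      · trivial
      · exact ⟨g.1, fun hw => ⟨hw, hw, rfl⟩, fun hw => mem_readersOf _ hw _ g.2⟩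
      · exact g
    | wtr j =>
      obtain ⟨d, e, g⟩ := hc.wok j
      rcases hs with ⟨hp, rfl, hk, rfl⟩ | ⟨hp, rfl, rfl⟩ | ⟨hp, rfl, rfl⟩ <;>
        rw [hp] at g <;>
        refine ⟨hc.stepW j _ rfl rfl rfl hc.mok le_rfl ⟨d, e, ?_⟩, Ext.rfl'⟩
      · exact g
      · exact ⟨g.1, g.2, g.2, rfl⟩
      · exact g
    | adt a =>
      rcases hs with ⟨hp, rfl, rfl⟩ | ⟨hp, rfl, rfl⟩ <;>
      exact ⟨⟨hc.mok, hc.nd, hc.rok, hc.wok⟩, Ext.rfl'⟩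
  | slrWrite p x e =>
    cases p with
    | rdr i =>
      obtain ⟨hp, rfl, rfl, rfl⟩ := hs
      obtain ⟨a, b, d, e, f, g⟩ := hc.rok i
      rw [hp] at g
      have hnd : ((c.slr (c.rst i).lsr ++ [Entry.r i]).map pid).Nodup := by
        refine nd_append (hc.nd _) fun e' he' hpid => ?_
        cases e' with
        | w j v h => simp [pid] at hpid
        | r k =>
          obtain rfl : k = i := by simpa [pid] using hpid
          exact lt_irrefl _ (g.2 _ he')
      rw [slide_eq _ _ hnd]
      have hE := ext_update (slr := c.slr) (c.rst i).lsr (Entry.r i)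
      refine ⟨⟨hc.mok.ext hE, nd_update hc.nd hnd, fun k => ?_, fun j => ?_⟩, hE⟩
      · by_cases hk : k = i
        · subst hk
          simp only [upR, Function.update_self]
          refine ⟨a, b, d.ext hE, e, fun y hy => ?_, g.1, by simp⟩
          rcases mem_update hy with h | ⟨-, h⟩
          · exact f y h
          · exact h.le
        · simp only [upR, Function.update_of_ne hk]
          refine (hc.rok k).frame hE le_rfl fun y hy => ?_
          rcases mem_update hy with h | ⟨h, -⟩
          · exact h
          · simp only [Entry.r.injEq] at h; exact absurd h hk
      · refine (hc.wok j).frame hE le_rfl fun y v h hy => ?_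
        rcases mem_update hy with h | ⟨h, -⟩
        · exact h
        · simp at h
    | wtr j =>
      obtain ⟨hp, rfl, rfl, rfl⟩ := hs
      obtain ⟨d, e, g⟩ := hc.wok j
      rw [hp] at g
      have hnd : ((c.slr (c.wst j).mc.widx ++
          [Entry.w j (c.wst j).v (c.wst j).toHelp]).map pid).Nodup := by
        refine nd_append (hc.nd _) fun e' he' hpid => ?_
        cases e' with
        | r k => simp [pid] at hpid
        | w k v h =>
          obtain rfl : k = j := by simpa [pid] using hpid
          exact lt_irrefl _ (g _ _ _ he')
      rw [slide_eq _ _ hnd]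
      have hE := ext_update (slr := c.slr) (c.wst j).mc.widx
        (Entry.w j (c.wst j).v (c.wst j).toHelp)
      refine ⟨⟨hc.mok.ext hE, nd_update hc.nd hnd, fun k => ?_, fun k => ?_⟩, hE⟩
      · refine (hc.rok k).frame hE le_rfl fun y hy => ?_
        rcases mem_update hy with h | ⟨h, -⟩
        · exact h
        · simp at h
      · by_cases hk : k = j
        · subst hk
          simp only [upW, Function.update_self]
          refine ⟨d.ext hE, e, fun y v h hy => ?_, ?_⟩
          · rcases mem_update hy with h | ⟨-, h⟩
            · exact (g y _ _ h).le
            · exact h.le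
          · simp [hasW, Entry.isW]
        · simp only [upW, Function.update_of_ne hk]
          refine (hc.wok k).frame hE le_rfl fun y v h hy => ?_
          rcases mem_update hy with h | ⟨h, -⟩
          · exact h
          · simp only [Entry.w.injEq] at h; exact absurd h.1 hk
    | adt a => exact hs.elim
  | mRead p v =>
    obtain ⟨rfl, hs⟩ := hs
    cases p with
    | rdr i =>
      obtain ⟨a, b, d, e, f, g⟩ := hc.rok i
      rcases hs with ⟨hp, rfl⟩ | ⟨hp, rfl⟩ <;> rw [hp] at g <;>
        refine ⟨hc.stepR i _ rfl rfl rfl hc.mok le_rfl ?_, Ext.rfl'⟩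
      · refine ⟨a, b, hc.mok, le_rfl, f, ?_⟩
        simp only [RPCOK] at g ⊢
        split_ifs with hw
        · exact ⟨g, hw⟩
        · simp only [RPCOK, upR]; omega
      · have hm := hc.mok.2.2 i
        have h0 := hc.mok.1
        simp only [RPCOK] at g
        split_ifs with hw
        · exact ⟨hm.1, hm.2.1.le, hc.mok, le_rfl, fun x hx => (f x hx).trans hw.le, trivial⟩
        · exact ⟨by simp only; omega, le_rfl, hc.mok, le_rfl, fun x hx => (f x hx).trans g.le,
            rfl, fun x hx => lt_of_le_of_lt (f x hx) g⟩
    | wtr j =>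
      obtain ⟨d, e, g⟩ := hc.wok j
      obtain ⟨hp, rfl⟩ := hs
      rw [hp] at g
      exact ⟨hc.stepW j _ rfl rfl rfl hc.mok le_rfl ⟨hc.mok, le_rfl, g⟩, Ext.rfl'⟩
    | adt a =>
      obtain ⟨hp, rfl⟩ := hs
      exact ⟨⟨hc.mok, hc.nd, hc.rok, hc.wok⟩, Ext.rfl'⟩
  | mWrite p v =>
    cases p with
    | rdr i =>
      obtain ⟨a, b, d, e, f, g⟩ := hc.rok i
      rcases hs with ⟨hp, rfl, rfl⟩ | ⟨hp, hw, rfl, rfl⟩ <;> rw [hp] at g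
      · have hge := wmax_ge c.M (mArg (c.rst i).mc (c.rst i).win (c.rst i).lsr (c.rst i).lval)
        have hlt : (c.rst i).lsr <
          (wmax c.M (mArg (c.rst i).mc (c.rst i).win (c.rst i).lsr (c.rst i).lval)).widx :=
          lt_of_lt_of_le (by simp [mArg]) hge.2
        exact ⟨hc.stepR i _ rfl rfl rfl (wmax_mok hc.mok (d.mArg g.2 g.1 _)) hge.1
          ⟨a, hlt.le, d, e.trans hge.1, f, hlt⟩, Ext.rfl'⟩
      · have hge := wmax_ge c.M (mArg (c.rst i).mc (c.rst i).win (c.rst i).lsr (c.rst i).lval)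
        have hlt : (c.rst i).lsr <
          (wmax c.M (mArg (c.rst i).mc (c.rst i).win (c.rst i).lsr (c.rst i).lval)).widx :=
          lt_of_lt_of_le (by simp [mArg]) hge.2
        exact ⟨hc.stepR i _ rfl rfl rfl (wmax_mok hc.mok (d.mArg g.1 (g.2.1 hw) _)) hge.1
          ⟨a, hlt.le, d, e.trans hge.1, f, g.2.1, g.2.2, fun _ => hlt⟩, Ext.rfl'⟩
    | wtr j =>
      obtain ⟨d, e, g⟩ := hc.wok j
      obtain ⟨hp, rfl, rfl⟩ := hs
      rw [hp] at g
      have hge := wmax_ge c.M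
        (mArg (c.wst j).mc (c.wst j).win (c.wst j).mc.widx (c.wst j).val)
      have hlt : (c.wst j).mc.widx <
        (wmax c.M (mArg (c.wst j).mc (c.wst j).win (c.wst j).mc.widx (c.wst j).val)).widx :=
        lt_of_lt_of_le (by simp [mArg]) hge.2
      exact ⟨hc.stepW j _ rfl rfl rfl (wmax_mok hc.mok (d.mArg rfl g.2 _)) hge.1
          ⟨d, e.trans hge.1, fun x v h hx => lt_of_le_of_lt (g.1 x v h hx) hlt⟩, Ext.rfl'⟩
    | adt a => exact hs.elim
  | hRead j k a =>
    obtain ⟨hp, -, -, rfl⟩ := hs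
    obtain ⟨d, e, g⟩ := hc.wok j
    rw [hp] at g
    refine ⟨hc.stepW j _ rfl rfl rfl hc.mok le_rfl ?_, Ext.rfl'⟩
    split_ifs
    · exact ⟨d, e, g⟩
    · refine ⟨d, e, ?_⟩
      simp only [hp]
      exact g
  | hWrite i x =>
    obtain ⟨hp, -, rfl⟩ := hs
    obtain ⟨a, b, d, e, f, g⟩ := hc.rok i
    rw [hp] at g
    exact ⟨hc.stepR i _ rfl rfl rfl hc.mok le_rfl ⟨a, b, d, e, f, g⟩, Ext.rfl'⟩
  | tau p =>
    cases p with
    | rdr i =>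
      obtain ⟨a, b, d, e, f, g⟩ := hc.rok i
      rcases hs with ⟨hp, hw, rfl⟩ | ⟨hp, rfl⟩ <;> rw [hp] at g <;>
        refine ⟨hc.stepR i _ rfl rfl rfl hc.mok le_rfl ⟨a, b, d, e, f, ?_⟩, Ext.rfl'⟩
      · exact ⟨g.2.1, g.2.2, fun h => by simp [hw] at h⟩
      · simp only
        split_ifs with hi
        · trivial
        · refine g.2.2 ?_
          by_contra hw
          exact hi (g.2.1 (by simpa using hw))
    | wtr j =>
      obtain ⟨hp, -, rfl⟩ := hs
      obtain ⟨d, e, g⟩ := hc.wok j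
      rw [hp] at g
      exact ⟨hc.stepW j _ rfl rfl rfl hc.mok le_rfl ⟨d, e, g⟩, Ext.rfl'⟩
    | adt a => exact hs.elim

/-- No index strictly between `x0` and `y` can record reader `i` any more. -/
def Clear (i : Fin m) (slr : ℤ → List (Entry m n)) (x0 y : ℤ) : Prop :=
  ∀ x, x0 < x → x < y → hasW (slr x) = true ∧ i ∉ readersOf (slr x)

theorem Clear.ext {i : Fin m} {s s' : ℤ → List (Entry m n)} {x0 y : ℤ} (he : Ext s s')
    (h : Clear i s x0 y) : Clear i s' x0 y := fun x h1 h2 =>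
  ⟨he.hasW (h x h1 h2).1, by rw [he.readers (h x h1 h2).1]; exact (h x h1 h2).2⟩

/-- Invariant of a READ of `i` that started with `lsr = x0`. -/
def QPC (i : Fin m) (slr : ℤ → List (Entry m n)) (x0 lsr : ℤ) : RPC → Prop
  | .idle => False
  | .retNow => True
  | .helpVal => True
  | .precheck => lsr = x0
  | .preM => lsr = x0
  | .preHelp => lsr = x0
  | .loopM => Clear i slr x0 (lsr + 1)
  | .annH => Clear i slr x0 lsr
  | .wSLR => Clear i slr x0 lsr
  | .rSLR => Clear i slr x0 lsr
  | .gVal => Clear i slr x0 lsr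
  | .helpChk => Clear i slr x0 lsr
  | .loopEnd => Clear i slr x0 lsr

theorem QPC.ext {i : Fin m} {s s' : ℤ → List (Entry m n)} {x0 y : ℤ} {pc : RPC} (he : Ext s s')
    (h : QPC i s x0 y pc) : QPC i s' x0 y pc := by
  cases pc <;> simp only [QPC] at h ⊢ <;> first | exact h | exact h.ext he

def Q (i : Fin m) (x0 : ℤ) (c : Config m n) : Prop :=
  QPC i c.slr x0 (c.rst i).lsr (c.rst i).pc

theorem Q.frame {i : Fin m} {x0 : ℤ} {c c' : Config m n} (h : Q i x0 c)
    (he : Ext c.slr c'.slr) (hr : c'.rst i = c.rst i) : Q i x0 c' := by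
  unfold Q at *; rw [hr]; exact h.ext he

/-- Steps of other processes do not change the local state of reader `i`. -/
theorem rst_eq_of_ne {c c' : Config m n} {l : Lbl m n} (hs : Step c l c') {i : Fin m}
    (h : procOf l ≠ .rdr i) : c'.rst i = c.rst i := by
  have key : ∀ k : Fin m, Proc.rdr (n := n) k ≠ .rdr i → ∀ s,
      Function.update c.rst k s i = c.rst i := fun k hk s =>
    Function.update_of_ne (fun e => hk (by rw [e])) _ _
  cases l with
  | invRead k => obtain ⟨-, rfl⟩ := hs; exact key k h _
  | respRead k v => obtain ⟨-, -, rfl⟩ := hs; exact key k h _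
  | invWrite j v => obtain ⟨-, rfl⟩ := hs; rfl
  | respWrite j => obtain ⟨-, rfl⟩ := hs; rfl
  | invAudit a => obtain ⟨-, rfl⟩ := hs; rfl
  | respAudit a A => obtain ⟨-, -, rfl⟩ := hs; rfl
  | slrRead p x win =>
    obtain ⟨-, hs⟩ := hs
    cases p with
    | rdr k =>
      rcases hs with ⟨-, -, rfl⟩ | ⟨-, -, rfl⟩ | ⟨-, -, rfl⟩ | ⟨-, -, rfl⟩ <;> exact key k h _
    | wtr j => rcases hs with ⟨-, -, -, rfl⟩ | ⟨-, -, rfl⟩ | ⟨-, -, rfl⟩ <;> rfl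
    | adt a => rcases hs with ⟨-, -, rfl⟩ | ⟨-, -, rfl⟩ <;> rfl
  | slrWrite p x e =>
    cases p with
    | rdr k => obtain ⟨-, -, -, rfl⟩ := hs; exact key k h _
    | wtr j => obtain ⟨-, -, -, rfl⟩ := hs; rfl
    | adt a => exact hs.elim
  | mRead p v =>
    obtain ⟨-, hs⟩ := hs
    cases p with
    | rdr k => rcases hs with ⟨-, rfl⟩ | ⟨-, rfl⟩ <;> exact key k h _
    | wtr j => obtain ⟨-, rfl⟩ := hs; rfl
    | adt a => obtain ⟨-, rfl⟩ := hs; rfl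
  | mWrite p v =>
    cases p with
    | rdr k => rcases hs with ⟨-, -, rfl⟩ | ⟨-, -, -, rfl⟩ <;> exact key k h _
    | wtr j => obtain ⟨-, -, rfl⟩ := hs; rfl
    | adt a => exact hs.elim
  | hRead j k a => obtain ⟨-, -, -, rfl⟩ := hs; rfl
  | hWrite k x => obtain ⟨-, -, rfl⟩ := hs; exact key k h _
  | tau p =>
    cases p with
    | rdr k => rcases hs with ⟨-, -, rfl⟩ | ⟨-, rfl⟩ <;> exact key k h _
    | wtr j => obtain ⟨-, -, rfl⟩ := hs; rfl
    | adt a => exact hs.elim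

theorem Q.step {i : Fin m} {x0 : ℤ} {c c' : Config m n} {l : Lbl m n} (hc : Inv c)
    (hx : -1 ≤ x0) (h : Q i x0 c) (hs : Step c l c') (hl : ∀ v, l ≠ .respRead i v) :
    Q i x0 c' := by
  have he := (hc.step hs).2
  by_cases hp : procOf l = .rdr i
  swap
  · exact h.frame he (rst_eq_of_ne hs hp)
  obtain ⟨a, b, d, e, f, g⟩ := hc.rok i
  unfold Q at h
  cases l with
  | invRead k =>
    obtain rfl : k = i := by simpa [procOf] using hp
    obtain ⟨hpc, rfl⟩ := hs
    rw [hpc] at h; exact h.elim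
  | respRead k v =>
    obtain rfl : k = i := by simpa [procOf] using hp
    exact absurd rfl (hl v)
  | invWrite j v => simp [procOf] at hp
  | respWrite j => simp [procOf] at hp
  | invAudit a => simp [procOf] at hp
  | respAudit a A => simp [procOf] at hp
  | slrRead p x win =>
    obtain rfl : p = .rdr i := hp
    obtain ⟨rfl, hs⟩ := hs
    rcases hs with ⟨hpc, rfl, rfl⟩ | ⟨hpc, rfl, rfl⟩ | ⟨hpc, rfl, rfl⟩ | ⟨hpc, rfl, rfl⟩ <;>
      rw [hpc] at h <;> simp only [Q, upR, Function.update_self]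
    · split_ifs
      · exact h
      · trivial
    · trivial
    · exact h
    · exact h
  | slrWrite p x e =>
    obtain rfl : p = .rdr i := hp
    obtain ⟨hpc, rfl, rfl, rfl⟩ := hs
    rw [hpc] at h
    have h' := QPC.ext he h
    simp only [Q, upR, Function.update_self]
    exact h'
  | mRead p v =>
    obtain rfl : p = .rdr i := hp
    obtain ⟨rfl, hs⟩ := hs
    rcases hs with ⟨hpc, rfl⟩ | ⟨hpc, rfl⟩ <;>
      rw [hpc] at h <;> simp only [Q, upR, Function.update_self]
    · simp only [QPC] at h
      split_ifs
      · exact h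
      · intro x h1 h2; omega
    · split_ifs with hw
      · trivial
      · intro x h1 h2
        by_cases hxl : x < (c.rst i).lsr + 1
        · exact h x h1 hxl
        · exact ⟨hc.mok.2.1 x (by omega) h2, (hc.mok.2.2 i).2.2 x (by omega) h2⟩
  | mWrite p v =>
    obtain rfl : p = .rdr i := hp
    rcases hs with ⟨hpc, rfl, rfl⟩ | ⟨hpc, hw, rfl, rfl⟩ <;>
      rw [hpc] at h <;> simp only [Q, upR, Function.update_self]
    · simp only [QPC] at h
      intro x h1 h2; omega
    · exact h
  | hRead j k a => simp [procOf] at hp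
  | hWrite k x =>
    obtain rfl : k = i := by simpa [procOf] using hp
    obtain ⟨hpc, -, rfl⟩ := hs
    rw [hpc] at h
    simp only [Q, upR, Function.update_self]
    exact h
  | tau p =>
    obtain rfl : p = .rdr i := hp
    rcases hs with ⟨hpc, hw, rfl⟩ | ⟨hpc, rfl⟩ <;> rw [hpc] at h g <;>
      simp only [Q, upR, Function.update_self]
    · exact h
    · split_ifs with hi
      · trivial
      · intro x h1 h2
        rcases eq_or_lt_of_le (show x ≤ (c.rst i).lsr by omega) with rfl | hlt
        · have hw : hasW (c.rst i).win = true := by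
            by_contra hw
            exact hi (g.2.1 (by simpa using hw))
          obtain ⟨-, f2, f3⟩ := g.1 hw
          exact ⟨f2, by rw [f3]; exact hi⟩
        · exact h x h1 hlt

theorem Exec.inv {v0 : Val} {j0 : Fin n} (E : Exec m n v0 j0) :
    ∀ t, t ≤ E.len → Inv (E.cfg t) := by
  intro t
  induction t with
  | zero => intro _; rw [E.h0]; exact Inv.init m n v0 j0
  | succ t ih => intro ht; exact ((ih (by omega)).step (E.hstep t (by omega))).1

theorem Exec.ext {v0 : Val} {j0 : Fin n} (E : Exec m n v0 j0) (t : ℕ) :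
    ∀ t', t ≤ t' → t' ≤ E.len → Ext (E.cfg t).slr (E.cfg t').slr := by
  intro t' h
  induction t', h using Nat.le_induction with
  | base => intro _; exact Ext.rfl'
  | succ k hk ih =>
    intro hl x
    exact (ih (by omega) x).trans (((E.inv k (by omega)).step (E.hstep k (by omega))).2 x)

/-- Lemma `no_help`.  Consider a READ operation by reader
`p_i` that starts (its invocation is step `tinv`) with local variable
`lsr = x₀` and that writes the value `x_k` to `H[i]` in some iteration of its
repeat loop (step `th`, within the same operation, i.e. with no response of
`p_i` in between).  Then for every index `x` with `x₀ < x < x_k` and every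
sequence `win` held in `SLR[x]` at any point of the execution,
`i ∉ READERS(win)`. -/
theorem no_help_between (m n : ℕ) (v0 : Val) (j0 : Fin n) (E : Exec m n v0 j0)
    (i : Fin m) (tinv th : ℕ) (x₀ xk : ℤ)
    (hinv : tinv < E.len) (hinvl : E.lbl tinv = .invRead i)
    (hx₀ : ((E.cfg tinv).rst i).lsr = x₀)
    (h₁ : tinv < th) (h₂ : th < E.len) (hthl : E.lbl th = .hWrite i xk)
    (hsameop : ∀ t, tinv < t → t < th → ∀ v, E.lbl t ≠ .respRead i v) :
    ∀ x : ℤ, x₀ < x → x < xk →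
      ∀ t, t ≤ E.len → i ∉ readersOf ((E.cfg t).slr x) := by
  intro x hx1 hx2 t ht
  have hlo : -1 ≤ x₀ := hx₀ ▸ ((E.inv tinv hinv.le).rok i).lo
  have hQ : ∀ s, tinv + 1 ≤ s → s ≤ th → Q i x₀ (E.cfg s) := by
    intro s hs
    induction s, hs using Nat.le_induction with
    | base =>
      intro _
      have hst := E.hstep tinv hinv
      rw [hinvl] at hst
      obtain ⟨-, hst⟩ := hst
      rw [hst]
      simp only [Q, upR, Function.update_self]
      split_ifs
      · exact hx₀
      · intro y h1 h2; omega
    | succ k hk ih =>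
      intro hkt
      exact (ih (by omega)).step (E.inv k (by omega)) hlo (E.hstep k (by omega))
        (hsameop k (by omega) (by omega))
  have hq := hQ th h₁ le_rfl
  have hst := E.hstep th h₂
  rw [hthl] at hst
  obtain ⟨hpc, rfl, -⟩ := hst
  unfold Q at hq
  rw [hpc] at hq
  obtain ⟨hw, hn⟩ := hq x hx1 hx2
  rcases le_total t th with h | h
  · exact fun hi => hn ((E.ext t th h h₂.le).sub x hi)
  · rw [(E.ext th t h ht).readers hw]; exact hn

end Alg1
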